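/- For every ν > 0 there exists a constant c such that for every n and every x ∈ 2^n with K(x) ≥ n − O(1), the set S_{x,c} = {p : l(p) < log n + O(1) and K(x|p) ≤ n − c} has at most ν·n elements. -/

import Mathlib

open scoped BigOperators
open scoped Classical

/-- The standard bijection between natural numbers and finite binary strings
(`ε ↦ 0`, `0 ↦ 1`, `1 ↦ 2`, `00 ↦ 3`, ...), inverse direction. -/
def strOfNat (n : ℕ) : List Bool := (n + 1).bits.dropLast

/-- Base-2 tetration: `1, 2, 2^2, 2^(2^2), ...`. -/
def tetr : ℕ → ℕ
  | 0 => 1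
  | k + 1 => 2 ^ tetr k

/-- The super-logarithm, the inverse of base-2 tetration. -/
noncomputable def slog (x : ℕ) : ℕ := sSup {k | tetr k ≤ x}

noncomputable section

/-- A machine given by a computable, monotone (in time) stepwise evaluation function
`step t p y n` : time `t`, program `p`, condition `y`, length parameter `n`
(the length parameter is always available). -/
structure Machine where
  step : ℕ → List Bool → ℕ → ℕ → Option ℕ
  computable_step :
    Computable fun q : (ℕ × List Bool) × ℕ × ℕ => step q.1.1 q.1.2 q.2.1 q.2.2
  mono : ∀ {t t' : ℕ} {p : List Bool} {y n v : ℕ}, t ≤ t' →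
      step t p y n = some v → step t' p y n = some v

namespace Machine

variable (M : Machine)

/-- `M(p|y,n) ↓ = v`. -/
def Outputs (p : List Bool) (y n v : ℕ) : Prop := ∃ t, M.step t p y n = some v

/-- `M(p|y,n) ↓`. -/
def HaltsOn (p : List Bool) (y n : ℕ) : Prop := ∃ v, M.Outputs p y n v

/-- the domain of `M` is prefix-free (for every condition). -/
def PrefixFree : Prop :=
  ∀ {p q : List Bool} {y n : ℕ}, M.HaltsOn p y n → M.HaltsOn q y n → p <+: q → p = q

/-- Kolmogorov complexity with respect to `M` (prefix-free complexity `K` when `M` is an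
optimal prefix-free interpreter, plain complexity `C` when `M` is an optimal plain machine). -/
def C (x y n : ℕ) : ℕ := sInf {l | ∃ p : List Bool, p.length = l ∧ M.Outputs p y n x}

/-- Time-bounded Kolmogorov complexity (`⊤` if no program produces `x` within time `t`). -/
def Ct (t x y n : ℕ) : ℕ∞ :=
  sInf {l : ℕ∞ | ∃ p : List Bool, (p.length : ℕ∞) = l ∧ M.step t p y n = some x}

/-- every value has a program, for every condition. -/
def Total : Prop := ∀ x y n, ∃ p : List Bool, M.Outputs p y n x

/-- `M` is an optimal universal prefix-free interpreter. -/
def POptimal : Prop := M.PrefixFree ∧ M.Total ∧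
  ∀ N : Machine, N.PrefixFree → ∃ c, ∀ (p : List Bool) (y n v : ℕ),
    N.Outputs p y n v → M.C v y n ≤ p.length + c

/-- `M` is an optimal universal plain machine. -/
def Optimal : Prop := M.Total ∧
  ∀ N : Machine, ∃ c, ∀ (p : List Bool) (y n v : ℕ),
    N.Outputs p y n v → M.C v y n ≤ p.length + c

/-- `p` is a shortest program for `x` (given `y`, `n`) on `M`. -/
def ShortestProg (p : List Bool) (x y n : ℕ) : Prop :=
  M.Outputs p y n x ∧ p.length = M.C x y n

/-- `u → v`: some program of length at most `c` computes `v` from `u` (and `n`). -/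
def Computes (c u n v : ℕ) : Prop := ∃ q : List Bool, q.length ≤ c ∧ M.Outputs q u n v

/-- `Ω^n_t`. -/
def OmegaT (n t : ℕ) : ℝ :=
  ∑' p : List Bool,
    if ∃ v, v < 2 ^ n ∧ M.step t p 0 n = some v then (2 : ℝ) ^ (-(p.length : ℤ)) else 0

/-- `Ω^n`. -/
def Omega (n : ℕ) : ℝ :=
  ∑' p : List Bool,
    if ∃ v, v < 2 ^ n ∧ M.Outputs p 0 n v then (2 : ℝ) ^ (-(p.length : ℤ)) else 0

/-- `t_k = min { t : Ω^n − Ω^n_t ≤ 2^{−k} }`. -/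
def tk (n k : ℕ) : ℕ := sInf {t | M.Omega n - M.OmegaT n t ≤ (2 : ℝ) ^ (-(k : ℤ))}

/-- the computational `m`-depth `k_x` of `x ∈ 2^n`, with additive constant `d`:
`k_x = min { k : K_{t_k}(x) ≤ K(x) + d }`. -/
def mdepth (d n x : ℕ) : ℕ :=
  sInf {k | ∃ p : List Bool, p.length ≤ M.C x 0 n + d ∧ M.step (M.tk n k) p 0 n = some x}

/-- `Ω^{n,j}`: the first `j` bits of the binary expansion of `Ω^n`, as a natural number. -/
def OmegaBits (n j : ℕ) : ℕ := ⌊M.Omega n * 2 ^ j⌋₊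

/-- `H^{n,j}`: the first `j` bits of the Halting sequence `H^n` of `M`, as a natural number. -/
def Hbits (n j : ℕ) : ℕ :=
  ∑ i ∈ Finset.range j, if M.HaltsOn (strOfNat i) 0 n then 2 ^ i else 0

/-- The Busy Beaver function of `M`: `BB(k) = max { M(p) : p ∈ 2^k, M(p)↓ }`. -/
def BB (n k : ℕ) : ℕ := sSup {v | ∃ p : List Bool, p.length = k ∧ M.Outputs p 0 n v}

end Machine

/-- `p` is a program on `M` computing the rational-valued function `P`. -/
def ProgForProb (M : Machine) (p : List Bool) (P : ℕ → ℚ) (n : ℕ) : Prop :=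
  ∀ y, M.Outputs p y n (Encodable.encode (P y))

/-- Complexity of the function `P` with respect to `M`. -/
noncomputable def KProb (M : Machine) (n : ℕ) (P : ℕ → ℚ) : ℕ :=
  sInf {l | ∃ p : List Bool, p.length = l ∧ ProgForProb M p P n}

/-- a (length conditional) semimeasure on `2^n`. -/
def IsSemimeasure (n : ℕ) (P : ℕ → ℚ) : Prop :=
  (∀ y, 0 ≤ P y) ∧ ∑ y ∈ Finset.range (2 ^ n), P y ≤ 1

/-- `p` is a program on `M` computing the partial function `F` (on binary strings). -/
def ProgForFun (M : Machine) (p : List Bool) (F : List Bool → Option ℕ) (n : ℕ) : Prop :=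
  ∀ d v, F d = some v ↔ M.Outputs p (Encodable.encode d) n v

/-- `F` has prefix-free domain. -/
def PrefixFreeFun (F : List Bool → Option ℕ) : Prop :=
  ∀ d d', (F d).isSome → (F d').isSome → d <+: d' → d = d'

/-- Complexity of the partial function `F` with respect to `M`. -/
noncomputable def KFun (M : Machine) (n : ℕ) (F : List Bool → Option ℕ) : ℕ :=
  sInf {l | ∃ p : List Bool, p.length = l ∧ ProgForFun M p F n}

/-- sufficient set statistic: `x ∈ S` and `K(S) + log|S| = K(x) ± c`. -/
def SufficientSet (Φ : Machine) (c n x : ℕ) (S : Finset ℕ) : Prop :=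
  x ∈ S ∧ S ⊆ Finset.range (2 ^ n) ∧
    Nat.dist (Φ.C (Encodable.encode S) 0 n + Nat.log 2 S.card) (Φ.C x 0 n) ≤ c

/-- sufficient probabilistic statistic: `P` computable semimeasure, `K(P) − log P(x) = K(x) ± c`. -/
def SufficientProb (Φ : Machine) (c n x : ℕ) (P : ℕ → ℚ) : Prop :=
  IsSemimeasure n P ∧ (∃ p, ProgForProb Φ p P n) ∧
    |(KProb Φ n P : ℝ) - Real.logb 2 (P x) - (Φ.C x 0 n : ℝ)| ≤ c

/-- sufficient function statistic: `F` computable prefix-free,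
`K(F) + l(d) = K(x) ± c` for some `d` with `F(d) = x`. -/
def SufficientFun (Φ : Machine) (c n x : ℕ) (F : List Bool → Option ℕ) : Prop :=
  PrefixFreeFun F ∧ (∃ p, ProgForFun Φ p F n) ∧
    ∃ d, F d = some x ∧ Nat.dist (KFun Φ n F + d.length) (Φ.C x 0 n) ≤ c

/-- minimal sufficient set statistic (within the constant `c`). -/
def MinimalSufficientSet (Φ : Machine) (c n x : ℕ) (S : Finset ℕ) : Prop :=
  SufficientSet Φ c n x S ∧ ∀ S' : Finset ℕ, SufficientSet Φ c n x S' →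
    Φ.C (Encodable.encode S) 0 n ≤ Φ.C (Encodable.encode S') 0 n + c

/-- `l^S_x`: the complexity of a minimal sufficient set statistic. -/
noncomputable def lSet (Φ : Machine) (c n x : ℕ) : ℕ :=
  sInf {l | ∃ S : Finset ℕ, SufficientSet Φ c n x S ∧ Φ.C (Encodable.encode S) 0 n = l}

/-- `l^P_x`: the complexity of a minimal sufficient probabilistic statistic. -/
noncomputable def lProb (Φ : Machine) (c n x : ℕ) : ℕ :=
  sInf {l | ∃ P : ℕ → ℚ, SufficientProb Φ c n x P ∧ KProb Φ n P = l}

/-- `l^F_x`: the complexity of a minimal sufficient function statistic. -/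
noncomputable def lFun (Φ : Machine) (c n x : ℕ) : ℕ :=
  sInf {l | ∃ F : List Bool → Option ℕ, SufficientFun Φ c n x F ∧ KFun Φ n F = l}

/-- weak sufficient set statistic: `C(S) + log|S| = K(x|C(S)) ± c`
(`Φ` the prefix-free interpreter, `Ψ` the plain machine). -/
def WeakSufficientSet (Φ Ψ : Machine) (c n x : ℕ) (S : Finset ℕ) : Prop :=
  x ∈ S ∧ S ⊆ Finset.range (2 ^ n) ∧
    Nat.dist (Ψ.C (Encodable.encode S) 0 n + Nat.log 2 S.card)
      (Φ.C x (Ψ.C (Encodable.encode S) 0 n) n) ≤ c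

/-- weak sufficient probabilistic statistic: `C(P) − log P(x) = K(x|C(P)) ± c`. -/
def WeakSufficientProb (Φ Ψ : Machine) (c n x : ℕ) (P : ℕ → ℚ) : Prop :=
  IsSemimeasure n P ∧ (∃ p, ProgForProb Ψ p P n) ∧
    |(KProb Ψ n P : ℝ) - Real.logb 2 (P x) - (Φ.C x (KProb Ψ n P) n : ℝ)| ≤ c

/-- weak sufficient function statistic: `C(F) + l(d) = K(x|C(F)) ± c` for some `d`, `F(d) = x`. -/
def WeakSufficientFun (Φ Ψ : Machine) (c n x : ℕ) (F : List Bool → Option ℕ) : Prop :=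
  (∃ p, ProgForFun Ψ p F n) ∧
    ∃ d, F d = some x ∧ Nat.dist (KFun Ψ n F + d.length) (Φ.C x (KFun Ψ n F) n) ≤ c

/-- typical semimeasure: `−log P(x) = K(x|P*) ± c`, `P*` a shortest plain description of `P`. -/
def TypicalProb (Φ Ψ : Machine) (c n x : ℕ) (P : ℕ → ℚ) : Prop :=
  IsSemimeasure n P ∧ (∃ p, ProgForProb Ψ p P n) ∧
    ∀ p : List Bool, ProgForProb Ψ p P n → p.length = KProb Ψ n P →
      |(-Real.logb 2 (P x)) - (Φ.C x (Encodable.encode p) n : ℝ)| ≤ c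

/-- the `BB`-depth `k'_x` with additive constant `d`:
`k'_x = min { k : K_{BB(k)}(x|k) ≤ K(x|k) + d }`. -/
noncomputable def kBB (Φ Ψ : Machine) (d n x : ℕ) : ℕ :=
  sInf {k | ∃ p : List Bool, p.length ≤ Φ.C x k n + d ∧ Φ.step (Ψ.BB n k) p k n = some x}

/-- The explicit weak sufficient statistic `P'_x`, with constants `d` (for `k'_x`),
`c` (scaling) and `c₂` (difference threshold):
`P'_x(y) = 2^{−K_{BB(k'_x)}(y|k'_x) + k'_x − c}` when
`K_{BB(k'_x)}(y|k'_x)` and `K_{BB(k'_x−1)}(y|k'_x)` differ by more than `c₂`, else `0`. -/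
noncomputable def Pprime (Φ Ψ : Machine) (d c c₂ n x : ℕ) (y : ℕ) : ℚ :=
  if Φ.Ct (Ψ.BB n (kBB Φ Ψ d n x)) y (kBB Φ Ψ d n x) n + (c₂ : ℕ∞) <
      Φ.Ct (Ψ.BB n (kBB Φ Ψ d n x - 1)) y (kBB Φ Ψ d n x) n then
    (2 : ℚ) ^ (kBB Φ Ψ d n x) /
      2 ^ (c + (Φ.Ct (Ψ.BB n (kBB Φ Ψ d n x)) y (kBB Φ Ψ d n x) n).toNat)
  else 0

/-- A prefix-free oracle machine: `step t p y n w` where `w` is the length-`t` initial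
segment of the oracle which may be queried within `t` steps. -/
structure OracleMachine where
  step : ℕ → List Bool → ℕ → ℕ → List Bool → Option ℕ
  computable_step :
    Computable fun q : ((ℕ × List Bool) × ℕ × ℕ) × List Bool =>
      step q.1.1.1 q.1.1.2 q.1.2.1 q.1.2.2 q.2
  mono : ∀ {t t' : ℕ} {p : List Bool} {y n v : ℕ} (O : ℕ → Bool), t ≤ t' →
      step t p y n (List.ofFn fun i : Fin t => O i) = some v →
      step t' p y n (List.ofFn fun i : Fin t' => O i) = some v

namespace OracleMachine

variable (M : OracleMachine) (O : ℕ → Bool)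

def Outputs (p : List Bool) (y n v : ℕ) : Prop :=
  ∃ t, M.step t p y n (List.ofFn fun i : Fin t => O i) = some v

def HaltsOn (p : List Bool) (y n : ℕ) : Prop := ∃ v, M.Outputs O p y n v

def PrefixFree : Prop :=
  ∀ {p q : List Bool} {y n : ℕ}, M.HaltsOn O p y n → M.HaltsOn O q y n → p <+: q → p = q

/-- oracle Kolmogorov complexity `K^O`. -/
def C (x y n : ℕ) : ℕ := sInf {l | ∃ p : List Bool, p.length = l ∧ M.Outputs O p y n x}

def Total : Prop := ∀ x y n, ∃ p : List Bool, M.Outputs O p y n x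

/-- `M` is an optimal universal prefix-free machine relative to the oracle `O`. -/
def POptimal : Prop := M.PrefixFree O ∧ M.Total O ∧
  ∀ N : OracleMachine, N.PrefixFree O → ∃ c, ∀ (p : List Bool) (y n v : ℕ),
    N.Outputs O p y n v → M.C O v y n ≤ p.length + c

end OracleMachine

/-- The Halting sequence of `Φ` as a single oracle (pairing index and length parameter). -/
noncomputable def Hseq (Φ : Machine) : ℕ → Bool :=
  fun i => decide (Φ.HaltsOn (strOfNat i.unpair.1) 0 i.unpair.2)

end

/-- All binary strings of length less than `m`. -/
def strs : ℕ → List (List Bool)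
  | 0 => []
  | m + 1 => [] :: ((strs m).map (List.cons true) ++ (strs m).map (List.cons false))

theorem mem_strs {m : ℕ} {p : List Bool} : p ∈ strs m ↔ p.length < m := by
  induction m generalizing p with
  | zero => simp [strs]
  | succ m ih =>
    rcases p with _ | ⟨b, p⟩
    · simp [strs]
    · cases b <;> simp [strs, ih]

theorem length_strs_lt (m : ℕ) : (strs m).length < 2 ^ m := by
  induction m with
  | zero => simp [strs]
  | succ m ih => simp [strs, pow_succ]; omega

theorem nodup_strs (m : ℕ) : (strs m).Nodup := by
  induction m with
  | zero => simp [strs]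
  | succ m ih =>
    simp only [strs, List.nodup_cons, List.nodup_append]
    refine ⟨by simp, ih.map (List.cons_injective), ih.map (List.cons_injective), ?_⟩
    intro a ha b hb
    simp only [List.mem_map] at ha hb
    obtain ⟨a, -, rfl⟩ := ha
    obtain ⟨b, -, rfl⟩ := hb
    simp

theorem primrec_strs : Primrec strs := by
  have hcons : ∀ b : Bool, Primrec fun q : ℕ × List (List Bool) => q.2.map (List.cons b) :=
    fun b => Primrec.list_map Primrec.snd
      (Primrec.list_cons.comp (Primrec.const b) Primrec.snd).to₂
  refine (Primrec.nat_rec₁ (f := fun _ l => [] :: (l.map (List.cons true) ++ l.map (List.cons false)))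
    ([] : List (List Bool)) ?_).of_eq ?_
  · exact Primrec.list_cons.comp (Primrec.const [])
      (Primrec.list_append.comp (hcons true) (hcons false))
  · intro m
    induction m with
    | zero => rfl
    | succ m ih => simp only [strs, ← ih]

/-- The number with the given binary digits, least significant digit first. -/
def bitsVal (w : List Bool) : ℕ := w.foldr (fun b r => 2 * r + b.toNat) 0

theorem primrec_bitsVal : Primrec bitsVal :=
  Primrec.list_foldr Primrec.id (Primrec.const 0)
    (Primrec.nat_add.comp
      (Primrec.nat_mul.comp (Primrec.const 2) (Primrec.snd.comp Primrec.snd))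
      ((Primrec.dom_finite Bool.toNat).comp (Primrec.fst.comp Primrec.snd))).to₂

theorem exists_bitsVal_eq {l i : ℕ} (h : i < 2 ^ l) :
    ∃ w : List Bool, w.length = l ∧ bitsVal w = i := by
  induction l generalizing i with
  | zero => exact ⟨[], rfl, by simp [bitsVal]; omega⟩
  | succ l ih =>
    obtain ⟨w, hw, hv⟩ := ih (i := i / 2) (by rw [pow_succ] at h; omega)
    refine ⟨decide (i % 2 = 1) :: w, by simp [hw], ?_⟩
    change 2 * bitsVal w + _ = i
    rw [hv]
    rcases Nat.mod_two_eq_zero_or_one i with h2 | h2 <;> simp [h2] <;> omega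

theorem primrec_two_pow : Primrec fun k : ℕ => 2 ^ k :=
  (Primrec₂.unpaired'.1 Nat.Primrec.pow).comp (Primrec.const 2) Primrec.id

theorem primrec_log_two : Primrec (Nat.log 2) := by
  refine (Primrec.nat_findGreatest (f := id) (p := fun n k => 2 ^ k ≤ n) Primrec.id
    (Primrec.nat_le.comp (primrec_two_pow.comp Primrec.snd) Primrec.fst)).of_eq fun n => ?_
  rw [id, Nat.findGreatest_eq_iff]
  refine ⟨Nat.log_le_self 2 n, fun h => Nat.pow_log_le_self 2 ?_, fun k hk _ => ?_⟩
  · rintro rfl; simp at h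
  · exact not_le.2 (Nat.lt_pow_of_log_lt (by norm_num) hk)

/-- Every machine is simulated by a primitive recursive stepwise evaluation function. -/
theorem Machine.exists_primrec_step (M : Machine) :
    ∃ g : ℕ × List Bool × ℕ × ℕ → Option ℕ, Primrec g ∧
      (∀ {t t' a v}, t ≤ t' → g (t, a) = some v → g (t', a) = some v) ∧
      ∀ p y n v, M.Outputs p y n v ↔ ∃ t, g (t, p, y, n) = some v := by
  have hcomp : Computable₂ fun (a : List Bool × ℕ × ℕ) (t : ℕ) =>
      M.step t a.1 a.2.1 a.2.2 :=
    M.computable_step.comp (g := fun q : (List Bool × ℕ × ℕ) × ℕ => ((q.2, q.1.1), q.1.2))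
      ((Computable.snd.pair (Computable.fst.comp Computable.fst)).pair
        (Computable.snd.comp Computable.fst))
  obtain ⟨c, hc⟩ := Nat.Partrec.Code.exists_code.1 (Partrec.rfindOpt hcomp)
  refine ⟨fun q => Nat.Partrec.Code.evaln q.1 c (Encodable.encode q.2), ?_, ?_, ?_⟩
  · exact Nat.Partrec.Code.primrec_evaln.comp
      ((Primrec.fst.pair (Primrec.const c)).pair (Primrec.encode.comp Primrec.snd))
  · intro t t' a v htt h
    exact Nat.Partrec.Code.evaln_mono htt h
  · intro p y n v
    have h1 : M.Outputs p y n v ↔ v ∈ Nat.Partrec.Code.eval c (Encodable.encode (p, y, n)) := by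
      rw [hc]
      simp only [Encodable.encodek, Part.coe_some, Part.bind_some, Part.mem_map_iff,
        Encodable.encode_nat, exists_eq_right]
      rw [Nat.rfindOpt_mono]
      · rfl
      · intro a m m' hm h
        exact M.mono hm h
    rw [h1, Nat.Partrec.Code.evaln_complete]
    rfl

/-- The complexity with respect to a total machine is attained by a program. -/
theorem Machine.Total.exists_length_eq_C {M : Machine} (hM : M.Total) (x y n : ℕ) :
    ∃ p : List Bool, p.length = M.C x y n ∧ M.Outputs p y n x := by
  obtain ⟨p, hp⟩ := hM x y n
  exact Nat.sInf_mem (s := {l | ∃ p : List Bool, p.length = l ∧ M.Outputs p y n x})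
    ⟨_, p, rfl, hp⟩

/-- The elements `x` such that `R t a x` for some `t`, listed without repetition
in the order of their discovery up to a given stage. -/
def enumList {α : Type*} (R : ℕ → α → ℕ → Bool) (a : α) : ℕ → List ℕ
  | 0 => []
  | s + 1 =>
    if R s.unpair.1 a s.unpair.2 = true ∧ s.unpair.2 ∉ enumList R a s then
      enumList R a s ++ [s.unpair.2] else enumList R a s

section enumList

variable {α : Type*} (R : ℕ → α → ℕ → Bool) (a : α)

theorem enumList_mono {s s' : ℕ} (h : s ≤ s') : enumList R a s <+: enumList R a s' := by
  induction h with
  | refl => exact List.prefix_rfl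
  | step _ ih =>
    refine ih.trans ?_
    rw [enumList]
    split_ifs
    · exact List.prefix_append _ _
    · exact List.prefix_rfl

theorem nodup_enumList (s : ℕ) : (enumList R a s).Nodup := by
  induction s with
  | zero => simp [enumList]
  | succ s ih =>
    rw [enumList]
    split_ifs with h
    · exact List.nodup_append.2 ⟨ih, by simp, by
        rintro b hb c hc rfl
        rw [List.mem_singleton.1 hc] at hb
        exact h.2 hb⟩
    · exact ih

theorem exists_of_mem_enumList {s x : ℕ} (h : x ∈ enumList R a s) :
    ∃ t, R t a x = true := by
  induction s with
  | zero => simp [enumList] at h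
  | succ s ih =>
    rw [enumList] at h
    split_ifs at h with h'
    · rcases List.mem_append.1 h with h | h
      · exact ih h
      · rw [List.mem_singleton.1 h]; exact ⟨_, h'.1⟩
    · exact ih h

theorem exists_mem_enumList {t x : ℕ} (h : R t a x = true) : ∃ s, x ∈ enumList R a s := by
  refine ⟨Nat.pair t x + 1, ?_⟩
  rw [enumList]
  split_ifs with h'
  · simp
  · simpa [h] using h'

theorem primrec_enumList [Primcodable α]
    (hR : Primrec fun q : ℕ × α × ℕ => R q.1 q.2.1 q.2.2) :
    Primrec₂ (enumList R) := by
  have hx : Primrec fun q : α × ℕ × List ℕ => q.2.1.unpair.2 :=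
    Primrec.snd.comp (Primrec.unpair.comp (Primrec.fst.comp Primrec.snd))
  have ht : Primrec fun q : α × ℕ × List ℕ => q.2.1.unpair.1 :=
    Primrec.fst.comp (Primrec.unpair.comp (Primrec.fst.comp Primrec.snd))
  have hl : Primrec fun q : α × ℕ × List ℕ => q.2.2 := Primrec.snd.comp Primrec.snd
  have hmem : PrimrecPred fun q : α × ℕ × List ℕ => q.2.1.unpair.2 ∈ q.2.2 :=
    ((PrimrecRel.exists_mem_list Primrec.eq).comp hl hx).of_eq fun q => by simp
  refine (Primrec.nat_rec (f := fun _ : α => ([] : List ℕ))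
    (g := fun a q => if R q.1.unpair.1 a q.1.unpair.2 = true ∧ q.1.unpair.2 ∉ q.2 then
      q.2 ++ [q.1.unpair.2] else q.2) (Primrec.const []) ?_).of_eq ?_
  · refine Primrec.ite (PrimrecPred.and ?_ hmem.not) (Primrec.list_concat.comp hl hx) hl
    exact Primrec.eq.comp (hR.comp (ht.pair (Primrec.fst.pair hx))) (Primrec.const true)
  · intro a s
    induction s with
    | zero => rfl
    | succ s ih => simp only [enumList, ← ih]

end enumList

theorem primrec_length_filter_exists {α β γ : Type*} [Primcodable α] [Primcodable β]
    [Primcodable γ] {l : α → List β} {l' : α → List γ} {R : γ → β → α → Prop}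
    (hl : Primrec l) (hl' : Primrec l')
    (hR : PrimrecPred fun q : γ × β × α => R q.1 q.2.1 q.2.2) :
    Primrec fun a => ((l a).filter fun b => ∃ c ∈ l' a, R c b a).length := by
  have hex : PrimrecRel fun (c : List γ) (q : β × α) => ∃ x ∈ c, R x q.1 q.2 :=
    PrimrecRel.exists_mem_list (R := fun x (q : β × α) => R x q.1 q.2) hR
  have hrel : PrimrecRel fun (b : β) (a : α) => ∃ c ∈ l' a, R c b a :=
    PrimrecRel.comp hex (hl'.comp Primrec.snd) Primrec.id
  exact Primrec.list_length.comp (hrel.listFilter.comp hl Primrec.id)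

/-- At stage `t`, more than a `2⁻ᵏ`-fraction (relative to `n`) of the conditions `p` of length less
than `log n + c₀` have been seen to compress `x` by `3 * c` bits. -/
noncomputable def manyConds (g : ℕ × List Bool × ℕ × ℕ → Option ℕ) (c₀ k t : ℕ) (a : ℕ × ℕ)
    (x : ℕ) : Bool :=
  decide (a.1 < 2 ^ k * ((strs (Nat.log 2 a.1 + c₀)).filter fun p =>
    ∃ q ∈ strs (a.1 + 1 - 3 * a.2), g (t, q, Encodable.encode p, a.1) = some x).length)

theorem primrec_manyConds {g : ℕ × List Bool × ℕ × ℕ → Option ℕ} (hg : Primrec g) (c₀ k : ℕ) :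
    Primrec fun q : ℕ × (ℕ × ℕ) × ℕ => manyConds g c₀ k q.1 q.2.1 q.2.2 := by
  have hn : Primrec fun q : ℕ × (ℕ × ℕ) × ℕ => q.2.1.1 :=
    Primrec.fst.comp (Primrec.fst.comp Primrec.snd)
  have hc : Primrec fun q : ℕ × (ℕ × ℕ) × ℕ => q.2.1.2 :=
    Primrec.snd.comp (Primrec.fst.comp Primrec.snd)
  have hcount := primrec_length_filter_exists
    (R := fun q p (b : ℕ × (ℕ × ℕ) × ℕ) =>
      g (b.1, q, Encodable.encode p, b.2.1.1) = some b.2.2)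
    (primrec_strs.comp (Primrec.nat_add.comp (primrec_log_two.comp hn) (Primrec.const c₀)))
    (primrec_strs.comp (Primrec.nat_sub.comp (Primrec.succ.comp hn)
      (Primrec.nat_mul.comp (Primrec.const 3) hc)))
    (Primrec.eq.comp (hg.comp (((Primrec.fst.comp (Primrec.snd.comp Primrec.snd))).pair
      (Primrec.fst.pair ((Primrec.encode.comp (Primrec.fst.comp Primrec.snd)).pair
        (hn.comp (Primrec.snd.comp Primrec.snd))))))
      (Primrec.option_some.comp (Primrec.snd.comp (Primrec.snd.comp
        (Primrec.snd.comp Primrec.snd)))))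
  have hlt := PrimrecPred.decide (Primrec.nat_lt.comp hn
    (Primrec.nat_mul.comp (Primrec.const (2 ^ k)) hcount))
  refine hlt.of_eq fun q => ?_
  unfold manyConds
  congr!

/-- Few values are compressible by `3 * c` bits relative to many conditions. -/
theorem length_le_of_manyConds {M : Machine} {g : ℕ × List Bool × ℕ × ℕ → Option ℕ}
    (hgM : ∀ p y n v, M.Outputs p y n v ↔ ∃ t, g (t, p, y, n) = some v) {c₀ k n c : ℕ}
    {L : List ℕ} (hL : L.Nodup) (h : ∀ x ∈ L, ∃ t, manyConds g c₀ k t (n, c) x = true)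
    (hfun : ∀ {p y n v w}, M.Outputs p y n v → M.Outputs p y n w → v = w) :
    L.length ≤ 2 ^ (k + c₀ + (n + 1 - 3 * c)) := by
  set m := n + 1 - 3 * c
  set P := (strs (Nat.log 2 n + c₀)).toFinset
  let r : ℕ → List Bool → Prop := fun x p =>
    ∃ q : List Bool, q.length < m ∧ M.Outputs q (Encodable.encode p) n x
  have habove : ∀ x ∈ L.toFinset, n + 1 ≤ 2 ^ k * (P.bipartiteAbove r x).card := by
    intro x hx
    obtain ⟨t, ht⟩ := h x (List.mem_toFinset.1 hx)
    simp only [manyConds, decide_eq_true_eq] at ht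
    refine (Nat.succ_le_of_lt ht).trans (Nat.mul_le_mul_left _ ?_)
    rw [← List.toFinset_card_of_nodup ((nodup_strs _).filter _)]
    refine Finset.card_le_card fun p hp => ?_
    simp only [List.mem_toFinset, List.mem_filter, decide_eq_true_eq] at hp
    obtain ⟨hp, q, hq, hqt⟩ := hp
    simp only [Finset.mem_bipartiteAbove, P, List.mem_toFinset]
    exact ⟨hp, q, mem_strs.1 hq, (hgM _ _ _ _).2 ⟨t, hqt⟩⟩
  have hbelow : ∀ p ∈ P, (L.toFinset.bipartiteBelow r p).card ≤ 2 ^ m := by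
    intro p _
    have h1 : (L.toFinset.bipartiteBelow r p).card ≤ (strs m).toFinset.card := by
      refine Finset.card_le_card_of_forall_subsingleton
        (fun x q => M.Outputs q (Encodable.encode p) n x) ?_ ?_
      · intro x hx
        obtain ⟨-, q, hq, hqx⟩ := (Finset.mem_bipartiteBelow r).1 hx
        exact ⟨q, List.mem_toFinset.2 (mem_strs.2 hq), hqx⟩
      · intro q _ x hx y hy
        exact hfun hx.2 hy.2
    exact h1.trans ((List.toFinset_card_le _).trans (length_strs_lt m).le)
  have hP : P.card ≤ (n + 1) * 2 ^ c₀ := by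
    refine (List.toFinset_card_le _).trans ((length_strs_lt _).le.trans ?_)
    rw [pow_add]
    refine Nat.mul_le_mul_right _ ?_
    rcases Nat.eq_zero_or_pos n with rfl | hn
    · simp
    · exact (Nat.pow_log_le_self 2 hn.ne').trans n.le_succ
  have hsum := Finset.sum_card_bipartiteAbove_eq_sum_card_bipartiteBelow
    (s := L.toFinset) (t := P) r
  have h1 : L.length * (n + 1) ≤ 2 ^ k * ∑ x ∈ L.toFinset, (P.bipartiteAbove r x).card := by
    rw [Finset.mul_sum, ← List.toFinset_card_of_nodup hL, ← smul_eq_mul]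
    exact Finset.card_nsmul_le_sum _ _ _ habove
  have h2 : ∑ p ∈ P, (L.toFinset.bipartiteBelow r p).card ≤ (n + 1) * 2 ^ c₀ * 2 ^ m :=
    (Finset.sum_le_card_nsmul _ _ _ hbelow).trans (Nat.mul_le_mul_right _ hP)
  rw [hsum] at h1
  have h3 : L.length * (n + 1) ≤ 2 ^ (k + c₀ + m) * (n + 1) := by
    refine h1.trans ((Nat.mul_le_mul_left _ h2).trans_eq ?_)
    rw [pow_add, pow_add]; ring
  exact Nat.le_of_mul_le_mul_right h3 n.succ_pos

theorem Machine.Outputs.unique {M : Machine} {p : List Bool} {y n v w : ℕ}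
    (hv : M.Outputs p y n v) (hw : M.Outputs p y n w) : v = w := by
  obtain ⟨t, ht⟩ := hv
  obtain ⟨t', ht'⟩ := hw
  have h1 := M.mono (le_max_left t t') ht
  have h2 := M.mono (le_max_right t t') ht'
  exact Option.some.inj (h1.symm.trans h2)

/-- The machine that on input `1ᶜ0w`, with `w` of the appropriate fixed length, outputs the
element with index `w` in the enumeration of the values compressible by `3 * c` bits relative to
many conditions. -/
noncomputable def indexMachine {g : ℕ × List Bool × ℕ × ℕ → Option ℕ} (hg : Primrec g) (c₀ k : ℕ) : Machine where
  step t p _ n :=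
    if p.idxOf false < p.length ∧
        p.length = p.idxOf false + 1 + (k + c₀ + (n + 1 - 3 * p.idxOf false)) then
      (enumList (manyConds g c₀ k) (n, p.idxOf false) t)[bitsVal (p.drop (p.idxOf false + 1))]?
    else none
  computable_step := by
    have hp : Primrec fun q : (ℕ × List Bool) × ℕ × ℕ => q.1.2 := Primrec.snd.comp Primrec.fst
    have hn : Primrec fun q : (ℕ × List Bool) × ℕ × ℕ => q.2.2 := Primrec.snd.comp Primrec.snd
    have hc : Primrec fun q : (ℕ × List Bool) × ℕ × ℕ => q.1.2.idxOf false :=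
      Primrec.list_idxOf.comp (Primrec.const false) hp
    have hlen : Primrec fun q : (ℕ × List Bool) × ℕ × ℕ => q.1.2.length :=
      Primrec.list_length.comp hp
    refine (Primrec.ite (PrimrecPred.and (Primrec.nat_lt.comp hc hlen) (Primrec.eq.comp hlen ?_))
      (Primrec.list_getElem?.comp ((primrec_enumList _ (primrec_manyConds hg c₀ k)).comp
        (hn.pair hc) (Primrec.fst.comp Primrec.fst)) (primrec_bitsVal.comp
          (Primrec.list_drop.comp (Primrec.succ.comp hc) hp))) (Primrec.const none)).to_comp
    exact Primrec.nat_add.comp (Primrec.succ.comp hc) (Primrec.nat_add.comp (Primrec.const _)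
      (Primrec.nat_sub.comp (Primrec.succ.comp hn) (Primrec.nat_mul.comp (Primrec.const 3) hc)))
  mono := by
    intro t t' p y n v htt h
    split_ifs at h ⊢ with h'
    obtain ⟨hi, rfl⟩ := List.getElem?_eq_some_iff.1 h
    have hpre := enumList_mono (manyConds g c₀ k) (n, p.idxOf false) htt
    rw [List.getElem?_eq_some_iff]
    exact ⟨hi.trans_le hpre.length_le, (hpre.getElem hi).symm⟩

theorem prefixFree_indexMachine {g : ℕ × List Bool × ℕ × ℕ → Option ℕ} (hg : Primrec g)
    (c₀ k : ℕ) : (indexMachine hg c₀ k).PrefixFree := by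
  have key : ∀ {p : List Bool} {y n : ℕ}, (indexMachine hg c₀ k).HaltsOn p y n →
      p.idxOf false < p.length ∧
        p.length = p.idxOf false + 1 + (k + c₀ + (n + 1 - 3 * p.idxOf false)) := by
    rintro p y n ⟨v, t, h⟩
    simp only [indexMachine] at h
    split_ifs at h with h'
    exact h'
  intro p q y n hp hq hpq
  obtain ⟨hp1, hp2⟩ := key hp
  obtain ⟨-, hq2⟩ := key hq
  have hidx : q.idxOf false = p.idxOf false := by
    obtain ⟨r, rfl⟩ := hpq
    exact List.idxOf_append_of_mem (List.idxOf_lt_length_iff.1 hp1)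
  rw [hidx] at hq2
  exact hpq.eq_of_length (hp2.trans hq2.symm)

theorem idxOf_false_replicate_append (c : ℕ) (w : List Bool) :
    (List.replicate c true ++ false :: w).idxOf false = c := by
  rw [List.idxOf_append_of_notMem (by simp)]
  simp

theorem exists_indexMachine_outputs {M : Machine} {g : ℕ × List Bool × ℕ × ℕ → Option ℕ}
    (hg : Primrec g) (hgM : ∀ p y n v, M.Outputs p y n v ↔ ∃ t, g (t, p, y, n) = some v)
    {c₀ k n c t x : ℕ} (h : manyConds g c₀ k t (n, c) x = true) (y : ℕ) :
    ∃ p : List Bool, p.length = c + 1 + (k + c₀ + (n + 1 - 3 * c)) ∧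
      (indexMachine hg c₀ k).Outputs p y n x := by
  obtain ⟨s, hs⟩ := exists_mem_enumList _ _ h
  have hlen := length_le_of_manyConds hgM (nodup_enumList (manyConds g c₀ k) (n, c) s)
    (fun x hx => exists_of_mem_enumList _ _ hx) Machine.Outputs.unique
  obtain ⟨i, hi, hix⟩ := List.getElem_of_mem hs
  obtain ⟨w, hw, hwi⟩ := exists_bitsVal_eq (hi.trans_le hlen)
  have hplen : (List.replicate c true ++ false :: w).length =
      c + 1 + (k + c₀ + (n + 1 - 3 * c)) := by
    simp [hw]; omega
  refine ⟨List.replicate c true ++ false :: w, hplen, s, ?_⟩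
  have hdrop : (List.replicate c true ++ false :: w).drop (c + 1) = w := by
    rw [List.drop_append]; simp
  simp only [indexMachine, idxOf_false_replicate_append, hdrop, hwi]
  rw [if_pos ⟨by omega, hplen⟩, List.getElem?_eq_some_iff]
  exact ⟨hi, hix⟩

theorem exists_manyConds {M : Machine} {g : ℕ × List Bool × ℕ × ℕ → Option ℕ}
    (hmono : ∀ {t t' a v}, t ≤ t' → g (t, a) = some v → g (t', a) = some v)
    (hgM : ∀ p y n v, M.Outputs p y n v ↔ ∃ t, g (t, p, y, n) = some v) (hM : M.Total)
    {c₀ k n c x : ℕ}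
    (h : n < 2 ^ k * Nat.card {p : List Bool //
      p.length < Nat.log 2 n + c₀ ∧ M.C x (Encodable.encode p) n + 3 * c ≤ n}) :
    ∃ t, manyConds g c₀ k t (n, c) x = true := by
  set S := (strs (Nat.log 2 n + c₀)).toFinset.filter
    fun p => M.C x (Encodable.encode p) n + 3 * c ≤ n
  have hS : ∀ p, p ∈ S ↔ p.length < Nat.log 2 n + c₀ ∧
      M.C x (Encodable.encode p) n + 3 * c ≤ n := by
    intro p
    simp [S, mem_strs]
  rw [Nat.subtype_card S hS] at h
  have hev : ∀ᶠ t in Filter.atTop, ∀ p ∈ S, ∃ q ∈ strs (n + 1 - 3 * c),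
      g (t, q, Encodable.encode p, n) = some x := by
    rw [Filter.eventually_all_finset]
    intro p hp
    obtain ⟨q, hq, hqx⟩ := hM.exists_length_eq_C x (Encodable.encode p) n
    obtain ⟨t, ht⟩ := (hgM _ _ _ _).1 hqx
    have := ((hS p).1 hp).2
    filter_upwards [Filter.eventually_ge_atTop t] with t' htt
    exact ⟨q, mem_strs.2 (by omega), hmono htt ht⟩
  obtain ⟨t, ht⟩ := hev.exists
  refine ⟨t, ?_⟩
  simp only [manyConds, decide_eq_true_eq]
  refine h.trans_le (Nat.mul_le_mul_left _ ?_)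
  rw [← List.toFinset_card_of_nodup ((nodup_strs _).filter _)]
  refine Finset.card_le_card fun p hp => ?_
  simp only [List.mem_toFinset, List.mem_filter, decide_eq_true_eq]
  exact ⟨mem_strs.2 ((hS p).1 hp).1, ht p hp⟩

/-- for every `ν > 0` there is `c` such that for every `x ∈ 2^n` with
`K(x) ≥ n − O(1)`, the set `S_{x,c} = {p : l(p) < log n + O(1), K(x|p) ≤ n − c}`
has at most `ν·n` elements. -/
theorem stmt_10 (Φ : Machine) (hΦ : Φ.POptimal) (c₀ : ℕ) :
    ∀ ν : ℝ, 0 < ν → ∃ c : ℕ, ∀ n : ℕ, ∀ x < 2 ^ n,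
      n ≤ Φ.C x 0 n + c₀ →
      (Nat.card {p : List Bool //
          p.length < Nat.log 2 n + c₀ ∧ Φ.C x (Encodable.encode p) n + c ≤ n} : ℝ) ≤
        ν * n := by
  intro ν hν
  obtain ⟨-, htot, hopt⟩ := hΦ
  obtain ⟨g, hg, hmono, hgM⟩ := Φ.exists_primrec_step
  obtain ⟨k, hk⟩ := exists_pow_lt_of_lt_one hν (by norm_num : (1 / 2 : ℝ) < 1)
  obtain ⟨b, hb⟩ := hopt _ (prefixFree_indexMachine hg c₀ k)
  set c := k + 2 * c₀ + b + 3 with hc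
  refine ⟨3 * c, fun n x _ hx => ?_⟩
  set N := Nat.card {p : List Bool //
    p.length < Nat.log 2 n + c₀ ∧ Φ.C x (Encodable.encode p) n + 3 * c ≤ n} with hN
  have hle : 2 ^ k * N ≤ n := by
    by_contra! hlt
    have hN0 : 0 < N := Nat.pos_of_ne_zero fun h0 => by simp [h0] at hlt
    obtain ⟨p, -, hp⟩ := (Nat.card_pos_iff.1 hN0).1
    obtain ⟨t, ht⟩ := exists_manyConds hmono hgM htot hlt
    obtain ⟨q, hq, hqx⟩ := exists_indexMachine_outputs hg hgM ht 0
    have := hb q 0 n x hqx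
    omega
  have hle' : (2 : ℝ) ^ k * N ≤ n := by exact_mod_cast hle
  calc (N : ℝ) = (1 / 2) ^ k * (2 ^ k * N) := by
        rw [← mul_assoc, ← mul_pow]; norm_num
    _ ≤ (1 / 2) ^ k * n := by gcongr
    _ ≤ ν * n := by gcongr
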